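/- arXiv:1908.01942 — 8 statements merged into one kernel-verified Lean document; each statement's English description precedes it below -/
import Mathlib

section
/- The electric potential Φ is infinitely differentiable on the complement of the knot: Φ is ContDiff of order ∞ (C^∞) on the open set (EuclideanSpace ℝ (Fin 3)) \ K. -/
section ParametricIntervalIntegral

open MeasureTheory Set Topology

variable {E G : Type*} [NormedAddCommGroup E] [NormedSpace ℝ E]
  [NormedAddCommGroup G] [NormedSpace ℝ G]

/-- Differentiation under the integral sign for a jointly `C^1` integrand. -/
theorem hasFDerivAt_intervalIntegral_of_contDiffOn [LocallyCompactSpace E] {U : Set E}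
    (hU : IsOpen U) {f : E × ℝ → G} (hf : ContDiffOn ℝ 1 f (U ×ˢ univ)) (a b : ℝ)
    {x₀ : E} (hx₀ : x₀ ∈ U) :
    HasFDerivAt (fun x => ∫ t in a..b, f (x, t))
      (∫ t in a..b, (fderiv ℝ f (x₀, t)).comp (ContinuousLinearMap.inl ℝ E ℝ)) x₀ := by
  have hopen : IsOpen (U ×ˢ (univ : Set ℝ)) := hU.prod isOpen_univ
  have hslice : ∀ x ∈ U, Continuous fun t : ℝ => f (x, t) := fun x hx =>
    hf.continuousOn.comp_continuous (by fun_prop) fun t => ⟨hx, mem_univ t⟩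
  have hf' : ContinuousOn
      (fun p => (fderiv ℝ f p).comp (ContinuousLinearMap.inl ℝ E ℝ)) (U ×ˢ univ) :=
    (hf.continuousOn_fderiv_of_isOpen hopen le_rfl).clm_comp continuousOn_const
  obtain ⟨k, hk, hkU, hkc⟩ := local_compact_nhds (hU.mem_nhds hx₀)
  obtain ⟨C, hC⟩ := (hkc.prod (isCompact_uIcc (a := a) (b := b))).exists_bound_of_continuousOn
    (hf'.mono (prod_mono hkU (subset_univ _)))
  refine intervalIntegral.hasFDerivAt_integral_of_dominated_of_fderiv_le
    (F := fun x t => f (x, t))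
    (F' := fun x t => (fderiv ℝ f (x, t)).comp (ContinuousLinearMap.inl ℝ E ℝ))
    (bound := fun _ => C) hk ?_ ((hslice x₀ hx₀).intervalIntegrable a b) ?_ ?_
    intervalIntegrable_const ?_
  · filter_upwards [hU.mem_nhds hx₀] with x hx
    exact (hslice x hx).aestronglyMeasurable
  · exact (hf'.comp_continuous (by fun_prop : Continuous fun t : ℝ => (x₀, t))
      fun t => ⟨hx₀, mem_univ t⟩).aestronglyMeasurable
  · exact ae_of_all _ fun t ht x hx => hC (x, t) ⟨hx, uIoc_subset_uIcc ht⟩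
  · refine ae_of_all _ fun t _ x hx => ?_
    have hd : DifferentiableAt ℝ f (x, t) :=
      (hf.differentiableOn one_ne_zero).differentiableAt
        (hopen.mem_nhds ⟨hkU hx, mem_univ t⟩)
    exact hd.hasFDerivAt.comp x (hasFDerivAt_prodMk_left x t)

end ParametricIntervalIntegral

section ParametricSmoothness

open Set

universe u

/-- The integral over a compact interval of a jointly smooth function is smooth in the
parameter. -/
theorem contDiffOn_intervalIntegral {E : Type u} [NormedAddCommGroup E] [NormedSpace ℝ E]
    [LocallyCompactSpace E] {U : Set E} (hU : IsOpen U) {G : Type u} [NormedAddCommGroup G]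
    [NormedSpace ℝ G] {f : E × ℝ → G} (hf : ContDiffOn ℝ (⊤ : ℕ∞) f (U ×ˢ univ)) (a b : ℝ) :
    ContDiffOn ℝ (⊤ : ℕ∞) (fun x => ∫ t in a..b, f (x, t)) U := by
  rw [contDiffOn_infty]
  intro n
  induction n generalizing G with
  | zero =>
    refine contDiffOn_zero.2 fun x hx => ?_
    exact (hasFDerivAt_intervalIntegral_of_contDiffOn hU (hf.of_le (by exact_mod_cast le_top))
      a b hx).continuousAt.continuousWithinAt
  | succ n ih =>
    have hderiv := fun x (hx : x ∈ U) => hasFDerivAt_intervalIntegral_of_contDiffOn hU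
      (hf.of_le (by exact_mod_cast le_top)) a b hx
    push_cast
    rw [contDiffOn_succ_iff_fderiv_of_isOpen hU]
    refine ⟨fun x hx => (hderiv x hx).differentiableAt.differentiableWithinAt, by simp, ?_⟩
    refine ContDiffOn.congr (ih (f := fun p =>
      (fderiv ℝ f p).comp (ContinuousLinearMap.inl ℝ E ℝ)) ?_) fun x hx => (hderiv x hx).fderiv
    exact (hf.fderiv_of_isOpen (hU.prod isOpen_univ) (by simp)).clm_comp contDiffOn_const

end ParametricSmoothness

/-- The electric potential of a uniformly charged smooth knot is `C^∞` on the
complement of the knot. -/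
theorem potential_smooth_off_knot
    (r : ℝ → EuclideanSpace ℝ (Fin 3))
    (hr : ContDiff ℝ (⊤ : ℕ∞) r)
    (hper : Function.Periodic r (2 * Real.pi))
    (hinj : Set.InjOn r (Set.Ico 0 (2 * Real.pi)))
    (hr' : ∀ t, deriv r t ≠ 0)
    (K : Set (EuclideanSpace ℝ (Fin 3))) (hK : K = Set.range r)
    (Φ : EuclideanSpace ℝ (Fin 3) → ℝ)
    (hΦ : ∀ x, Φ x = ∫ t in (0:ℝ)..(2 * Real.pi), ‖deriv r t‖ / ‖x - r t‖) :
    ContDiffOn ℝ (⊤ : ℕ∞) Φ ((Set.univ : Set (EuclideanSpace ℝ (Fin 3))) \ K) := by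
  have hKc : IsCompact K := by
    rw [hK, ← hper.image_Icc Real.two_pi_pos 0]
    exact isCompact_Icc.image hr.continuous
  have hU : IsOpen (Set.univ \ K) := isOpen_univ.sdiff hKc.isClosed
  have hspeed : ContDiff ℝ (⊤ : ℕ∞) (fun t => ‖deriv r t‖) :=
    (contDiff_infty_iff_deriv.1 hr).2.norm ℝ hr'
  have hne : ∀ p ∈ (Set.univ \ K) ×ˢ (Set.univ : Set ℝ), p.1 - r p.2 ≠ 0 := by
    rintro ⟨x, t⟩ ⟨⟨-, hx⟩, -⟩ h
    exact hx (hK ▸ ⟨t, (sub_eq_zero.1 h).symm⟩)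
  have hdist : ContDiffOn ℝ (⊤ : ℕ∞)
      (fun p : EuclideanSpace ℝ (Fin 3) × ℝ => ‖p.1 - r p.2‖) ((Set.univ \ K) ×ˢ Set.univ) :=
    (contDiff_fst.sub (hr.comp contDiff_snd)).contDiffOn.norm ℝ hne
  have hint := (hspeed.comp contDiff_snd).contDiffOn.div hdist
    fun p hp => norm_ne_zero_iff.2 (hne p hp)
  exact (contDiffOn_intervalIntegral hU hint 0 (2 * Real.pi)).congr fun x _ => hΦ x
end

section
/- The electric potential Φ is harmonic on the complement of the knot: for every x ∉ K and every orthonormal basis (e i) of EuclideanSpace ℝ (Fin 3), the Laplacian of Φ vanishes at x, i.e. ∑ i, (iteratedFDeriv ℝ 2 Φ x) (e i) (e i) = 0. -/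
/-- Differentiation under an interval integral, when the integrand and its derivative are jointly
continuous over an open set of parameters. -/
theorem hasFDerivAt_intervalIntegral_of_continuousOn
    {H E : Type*} [NormedAddCommGroup H] [NormedSpace ℝ H] [ProperSpace H]
    [NormedAddCommGroup E] [NormedSpace ℝ E] {U : Set H} (hU : IsOpen U)
    {F : H → ℝ → E} {F' : H → ℝ → H →L[ℝ] E}
    (hF : ContinuousOn (Function.uncurry F) (U ×ˢ Set.univ))
    (hF' : ContinuousOn (Function.uncurry F') (U ×ˢ Set.univ))
    (hd : ∀ x ∈ U, ∀ t, HasFDerivAt (fun y => F y t) (F' x t) x) (a b : ℝ)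
    {x : H} (hx : x ∈ U) :
    HasFDerivAt (fun y => ∫ t in a..b, F y t) (∫ t in a..b, F' x t) x := by
  have hFc {y : H} (hy : y ∈ U) : Continuous (F y) :=
    hF.comp_continuous (f := fun t => (y, t)) (by fun_prop) fun t => ⟨hy, trivial⟩
  have hFc' : Continuous (F' x) :=
    hF'.comp_continuous (f := fun t => (x, t)) (by fun_prop) fun t => ⟨hx, trivial⟩
  obtain ⟨ε, hε, hball⟩ := Metric.nhds_basis_closedBall.mem_iff.1 (hU.mem_nhds hx)
  obtain ⟨C, hC⟩ := ((isCompact_closedBall x ε).prod (isCompact_uIcc (a := a) (b := b)))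
    |>.exists_bound_of_continuousOn (hF'.mono (Set.prod_mono hball (Set.subset_univ _)))
  refine intervalIntegral.hasFDerivAt_integral_of_dominated_of_fderiv_le
    (bound := fun _ => C) (Metric.closedBall_mem_nhds x hε) ?_
    ((hFc hx).intervalIntegrable _ _) hFc'.aestronglyMeasurable ?_
    intervalIntegrable_const ?_
  · filter_upwards [hU.mem_nhds hx] with y hy using (hFc hy).aestronglyMeasurable
  · exact Filter.Eventually.of_forall fun t ht y hy =>
      hC (y, t) ⟨hy, Set.uIoc_subset_uIcc ht⟩
  · exact Filter.Eventually.of_forall fun t _ y hy => hd y (hball hy) t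

theorem continuousOn_uncurry_smul_comp_sub {E : Type*} [NormedAddCommGroup E]
    {G : Type*} [NormedAddCommGroup G] [NormedSpace ℝ G]
    {k : E → G} (hk : ContinuousOn k {0}ᶜ) {r : ℝ → E} (hr : Continuous r)
    {w : ℝ → ℝ} (hw : Continuous w) {U : Set E} (hne : ∀ y ∈ U, ∀ t, y ≠ r t) :
    ContinuousOn (Function.uncurry fun y t => w t • k (y - r t)) (U ×ˢ Set.univ) := by
  have hw' : Continuous fun p : E × ℝ => w p.2 := by fun_prop
  exact hw'.continuousOn.smul
    (hk.comp (f := fun p : E × ℝ => p.1 - r p.2) (by fun_prop)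
      fun p hp => sub_ne_zero.2 (hne _ hp.1 _))

theorem HasFDerivAt.const_smul_comp_sub_const
    {E : Type*} [NormedAddCommGroup E] [NormedSpace ℝ E]
    {G : Type*} [NormedAddCommGroup G] [NormedSpace ℝ G]
    {k : E → G} {k' : E →L[ℝ] G} {z a : E} (h : HasFDerivAt k k' (z - a))
    (c : ℝ) :
    HasFDerivAt (fun y => c • k (y - a)) (c • k') z :=
  (h.comp z ((hasFDerivAt_id z).sub_const a)).const_smul c

section NewtonKernel

set_option maxSynthPendingDepth 3

variable {E : Type*} [NormedAddCommGroup E] [InnerProductSpace ℝ E]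

/-- The inner product of a real inner product space as a continuous bilinear map. -/
noncomputable def realInnerCLM : E →L[ℝ] E →L[ℝ] ℝ :=
  (isBoundedBilinearMap_inner (𝕜 := ℝ)).toContinuousLinearMap

@[simp]
theorem realInnerCLM_apply (v w : E) : realInnerCLM v w = inner ℝ v w := rfl

/-- The derivative of `y ↦ ‖y‖⁻¹` away from the origin. -/
noncomputable def newtonKernelFDeriv (y : E) : E →L[ℝ] ℝ :=
  (-(‖y‖ ^ 3)⁻¹) • realInnerCLM y

/-- The second derivative of `y ↦ ‖y‖⁻¹` away from the origin. -/
noncomputable def newtonKernelHessian (y : E) : E →L[ℝ] E →L[ℝ] ℝ :=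
  (-(‖y‖ ^ 3)⁻¹) • realInnerCLM + ((3 * (‖y‖ ^ 5)⁻¹) • realInnerCLM y).smulRight (realInnerCLM y)

theorem hasFDerivAt_norm_of_ne_zero {y : E} (hy : y ≠ 0) :
    HasFDerivAt (fun z : E => ‖z‖) (‖y‖⁻¹ • realInnerCLM y) y := by
  have hn : ‖y‖ ≠ 0 := norm_ne_zero_iff.2 hy
  have h := (hasStrictFDerivAt_norm_sq y).hasFDerivAt.sqrt (by positivity)
  simp only [Real.sqrt_sq (norm_nonneg _)] at h
  refine h.congr_fderiv ?_
  ext v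
  simp
  field_simp

theorem hasFDerivAt_newtonKernel {y : E} (hy : y ≠ 0) :
    HasFDerivAt (fun z : E => ‖z‖⁻¹) (newtonKernelFDeriv y) y := by
  have hn : ‖y‖ ≠ 0 := norm_ne_zero_iff.2 hy
  refine ((hasDerivAt_inv hn).comp_hasFDerivAt y (hasFDerivAt_norm_of_ne_zero hy)).congr_fderiv ?_
  ext v
  simp [newtonKernelFDeriv]
  field_simp

theorem hasFDerivAt_newtonKernelFDeriv {y : E} (hy : y ≠ 0) :
    HasFDerivAt (newtonKernelFDeriv (E := E)) (newtonKernelHessian y) y := by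
  have hn : ‖y‖ ≠ 0 := norm_ne_zero_iff.2 hy
  have h := ((((hasDerivAt_pow 3 ‖y‖).inv (pow_ne_zero 3 hn)).neg).comp_hasFDerivAt y
    (hasFDerivAt_norm_of_ne_zero hy)).smul
      realInnerCLM.hasFDerivAt
  refine h.congr_fderiv ?_
  ext v w
  simp [newtonKernelHessian]
  field_simp

theorem continuousOn_newtonKernelFDeriv :
    ContinuousOn (newtonKernelFDeriv (E := E)) {0}ᶜ := fun _ hy =>
  (hasFDerivAt_newtonKernelFDeriv hy).continuousAt.continuousWithinAt

theorem continuousOn_newtonKernelHessian :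
    ContinuousOn (newtonKernelHessian (E := E)) {0}ᶜ := by
  have h (n : ℕ) : ContinuousOn (fun y : E => (‖y‖ ^ n)⁻¹) {0}ᶜ :=
    ContinuousOn.inv₀ (by fun_prop) fun y hy => pow_ne_zero n (norm_ne_zero_iff.2 hy)
  have hs : Continuous fun y : E => realInnerCLM y := (realInnerCLM (E := E)).continuous
  refine ((h 3).neg.smul continuousOn_const).add ?_
  exact Continuous.comp_continuousOn
    (g := fun p : (E →L[ℝ] ℝ) × (E →L[ℝ] ℝ) => p.1.smulRight p.2)
    (ContinuousLinearMap.smulRightL ℝ E (E →L[ℝ] ℝ)).continuous₂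
    (((continuousOn_const.mul (h 5)).smul hs.continuousOn).prodMk hs.continuousOn)

theorem sum_newtonKernelHessian_eq_zero {ι : Type*} [Fintype ι] (hι : Fintype.card ι = 3)
    (e : OrthonormalBasis ι ℝ E) {y : E} (hy : y ≠ 0) :
    ∑ i, newtonKernelHessian y (e i) (e i) = 0 := by
  have hn : ‖y‖ ≠ 0 := norm_ne_zero_iff.2 hy
  have hs : ∑ i, inner ℝ y (e i) * inner ℝ y (e i) = ‖y‖ ^ 2 := by
    simpa only [sq] using e.sum_sq_inner_left y
  simp only [newtonKernelHessian, add_apply, smul_apply,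
    ContinuousLinearMap.smulRight_apply, realInnerCLM_apply,
    smul_eq_mul, real_inner_self_eq_norm_sq, e.norm_eq_one, Finset.sum_add_distrib,
    mul_assoc, ← Finset.mul_sum, hs]
  simp [hι]
  field_simp
  ring

/-- In a three-dimensional space, the Newtonian potential of a charge distribution carried by a
curve is harmonic on every open set that does not meet the curve. -/
theorem sum_iteratedFDeriv_two_curvePotential_eq_zero [ProperSpace E] {ι : Type*} [Fintype ι]
    (hι : Fintype.card ι = 3) (e : OrthonormalBasis ι ℝ E) {r : ℝ → E} (hr : Continuous r)
    {w : ℝ → ℝ} (hw : Continuous w) (a b : ℝ) {U : Set E} (hU : IsOpen U)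
    (hne : ∀ y ∈ U, ∀ t, y ≠ r t) {x : E} (hx : x ∈ U) :
    ∑ i, (iteratedFDeriv ℝ 2 (fun y => ∫ t in a..b, w t • ‖y - r t‖⁻¹) x) ![e i, e i] = 0 := by
  set P : E → ℝ := fun y => ∫ t in a..b, w t • ‖y - r t‖⁻¹
  have h0 : ContinuousOn (fun y : E => ‖y‖⁻¹) {0}ᶜ := fun y hy =>
    (hasFDerivAt_newtonKernel hy).continuousAt.continuousWithinAt
  have hD := continuousOn_uncurry_smul_comp_sub continuousOn_newtonKernelFDeriv hr hw hne
  have h1 : ∀ y ∈ U, HasFDerivAt P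
      (∫ t in a..b, w t • newtonKernelFDeriv (y - r t)) y := by
    intro y hy
    exact hasFDerivAt_intervalIntegral_of_continuousOn hU
      (continuousOn_uncurry_smul_comp_sub h0 hr hw hne) hD
      (fun z hz t => (hasFDerivAt_newtonKernel
        (sub_ne_zero.2 (hne z hz t))).const_smul_comp_sub_const (w t)) _ _ hy
  have hH := continuousOn_uncurry_smul_comp_sub continuousOn_newtonKernelHessian hr hw hne
  have h2 := hasFDerivAt_intervalIntegral_of_continuousOn hU hD hH
    (fun z hz t => (hasFDerivAt_newtonKernelFDeriv
      (sub_ne_zero.2 (hne z hz t))).const_smul_comp_sub_const (w t)) a b hx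
  have hfd := (h2.congr_of_eventuallyEq (f₁ := fderiv ℝ P) (by
    filter_upwards [hU.mem_nhds hx] with y hy using (h1 y hy).fderiv)).fderiv
  have hint : IntervalIntegrable (fun t => w t • newtonKernelHessian (x - r t))
      MeasureTheory.volume a b :=
    (hH.comp_continuous (f := fun t => (x, t))
      (by fun_prop) fun t => ⟨hx, trivial⟩).intervalIntegrable _ _
  let T : (E →L[ℝ] E →L[ℝ] ℝ) →L[ℝ] ℝ :=
    ∑ i, (ContinuousLinearMap.apply ℝ ℝ (e i)).comp (ContinuousLinearMap.apply ℝ _ (e i))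
  have hT (B) : T B = ∑ i, B (e i) (e i) := by
    simp [T]
  calc
    _ = T (fderiv ℝ (fderiv ℝ P) x) := by
      simp [hT, iteratedFDeriv_two_apply]
    _ = ∫ t in a..b, T (w t • newtonKernelHessian (x - r t)) := by
      rw [hfd, T.intervalIntegral_comp_comm hint]
    _ = 0 := by
      simp [hT, ← Finset.mul_sum,
        sum_newtonKernelHessian_eq_zero hι e (sub_ne_zero.2 (hne x hx _))]

end NewtonKernel

/-- The electric potential of a uniformly charged smooth knot is harmonic on the
complement of the knot: its Laplacian vanishes there. -/
theorem potential_harmonic_off_knot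
    (r : ℝ → EuclideanSpace ℝ (Fin 3))
    (hr : ContDiff ℝ (⊤ : ℕ∞) r)
    (hper : Function.Periodic r (2 * Real.pi))
    (hinj : Set.InjOn r (Set.Ico 0 (2 * Real.pi)))
    (hr' : ∀ t, deriv r t ≠ 0)
    (K : Set (EuclideanSpace ℝ (Fin 3))) (hK : K = Set.range r)
    (Φ : EuclideanSpace ℝ (Fin 3) → ℝ)
    (hΦ : ∀ x, Φ x = ∫ t in (0:ℝ)..(2 * Real.pi), ‖deriv r t‖ / ‖x - r t‖)
    (x : EuclideanSpace ℝ (Fin 3)) (hx : x ∉ K)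
    (e : OrthonormalBasis (Fin 3) ℝ (EuclideanSpace ℝ (Fin 3))) :
    ∑ i, (iteratedFDeriv ℝ 2 Φ x) ![e i, e i] = 0 := by
  have hΦ' : Φ = fun y => ∫ t in (0:ℝ)..(2 * Real.pi), ‖deriv r t‖ • ‖y - r t‖⁻¹ := by
    ext y
    simp only [hΦ, div_eq_mul_inv, smul_eq_mul]
  have hK_closed : IsClosed K :=
    hK ▸ (hper.compact_of_continuous Real.two_pi_pos.ne' hr.continuous).isClosed
  rw [hΦ']
  refine sum_iteratedFDeriv_two_curvePotential_eq_zero (Fintype.card_fin 3) e hr.continuous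
    (hr.continuous_deriv (by exact_mod_cast le_top)).norm 0 (2 * Real.pi)
    hK_closed.isOpen_compl ?_ hx
  rintro y hy t rfl
  exact hy (hK ▸ Set.mem_range_self t)
end

section
/- For every x ∉ K, the gradient of the electric potential is given by differentiating under the integral sign: gradient Φ x = ∫ t in 0..2π, (‖deriv r t‖ / ‖x − r t‖^3) • (r t − x). (Its negative is the electric field E = −∇Φ.) -/
section InverseDistance

variable {E : Type*} [NormedAddCommGroup E] [InnerProductSpace ℝ E]

/-- The derivative of the potential of a point charge of strength `c` at `p`. -/
theorem hasFDerivAt_const_div_norm_sub (c : ℝ) {p y : E} (hy : y ≠ p) :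
    HasFDerivAt (fun z => c / ‖z - p‖) (innerSL ℝ ((c / ‖y - p‖ ^ 3) • (p - y))) y := by
  have hpos : 0 < ‖y - p‖ := norm_pos_iff.2 (sub_ne_zero.2 hy)
  have hsq : HasFDerivAt (fun z => ‖z - p‖ ^ 2)
      (2 • (innerSL ℝ (y - p)).comp (ContinuousLinearMap.id ℝ E)) y :=
    ((hasFDerivAt_id y).sub_const p).norm_sq
  have hnorm := hsq.sqrt (pow_pos hpos 2).ne'
  simp only [Real.sqrt_sq (norm_nonneg _)] at hnorm
  have hdiv : HasDerivAt (fun s : ℝ => c / s) (-c / ‖y - p‖ ^ 2) ‖y - p‖ := by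
    simpa using (hasDerivAt_const ‖y - p‖ c).fun_div (hasDerivAt_id _) hpos.ne'
  refine (hdiv.comp_hasFDerivAt y hnorm).congr_fderiv ?_
  ext v
  simp only [smul_apply, ContinuousLinearMap.comp_apply,
    ContinuousLinearMap.id_apply, innerSL_apply_apply, real_inner_smul_left, smul_eq_mul,
    nsmul_eq_mul, ← neg_sub y p, inner_neg_left]
  field_simp
  simp

/-- Away from a continuous curve, the potential of a continuous charge density on it may be
differentiated under the integral sign. -/
theorem hasGradientAt_integral_div_norm_sub [CompleteSpace E] {a b : ℝ} {r : ℝ → E} {w : ℝ → ℝ}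
    (hr : Continuous r) (hw : Continuous w) {x : E} {δ : ℝ} (hδ : 0 < δ)
    (hx : ∀ t, δ ≤ ‖x - r t‖) :
    HasGradientAt (fun y => ∫ t in a..b, w t / ‖y - r t‖)
      (∫ t in a..b, (w t / ‖x - r t‖ ^ 3) • (r t - x)) x := by
  have hball : ∀ y ∈ Metric.ball x (δ / 2), ∀ t, δ / 2 ≤ ‖y - r t‖ := fun y hy t => by
    have h := norm_sub_le_norm_sub_add_norm_sub x y (r t)
    rw [Metric.mem_ball, dist_eq_norm, norm_sub_rev] at hy
    linarith [hx t]
  have hs : Metric.ball x (δ / 2) ∈ nhds x := Metric.ball_mem_nhds x (half_pos hδ)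
  have hne : ∀ y ∈ Metric.ball x (δ / 2), ∀ t, ‖y - r t‖ ≠ 0 := fun y hy t =>
    ((half_pos hδ).trans_le (hball y hy t)).ne'
  have hcont : ∀ y ∈ Metric.ball x (δ / 2), Continuous fun t => w t / ‖y - r t‖ := fun y hy =>
    hw.div (continuous_const.sub hr).norm (hne y hy)
  have hgrad : Continuous fun t => (w t / ‖x - r t‖ ^ 3) • (r t - x) :=
    (hw.div ((continuous_const.sub hr).norm.pow 3)
      fun t => pow_ne_zero 3 (hne x (mem_of_mem_nhds hs) t)).smul (hr.sub continuous_const)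
  have hfderiv : Continuous fun t => innerSL ℝ ((w t / ‖x - r t‖ ^ 3) • (r t - x)) :=
    (innerSL ℝ).continuous.comp hgrad
  have key := intervalIntegral.hasFDerivAt_integral_of_dominated_of_fderiv_le
    (μ := MeasureTheory.volume) (a := a) (b := b) (F := fun y t => w t / ‖y - r t‖)
    (F' := fun y t => innerSL ℝ ((w t / ‖y - r t‖ ^ 3) • (r t - y)))
    (bound := fun t => |w t| / (δ / 2) ^ 2) hs
    (Filter.mem_of_superset hs fun y hy => (hcont y hy).aestronglyMeasurable)
    ((hcont x (mem_of_mem_nhds hs)).intervalIntegrable a b)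
    hfderiv.aestronglyMeasurable
    (Filter.Eventually.of_forall fun t _ y hy => by
      have h := hball y hy t
      have hpos := (half_pos hδ).trans_le h
      rw [innerSL_apply_norm, norm_smul, norm_div, norm_pow, norm_norm, Real.norm_eq_abs,
        norm_sub_rev (r t)]
      calc |w t| / ‖y - r t‖ ^ 3 * ‖y - r t‖ = |w t| / ‖y - r t‖ ^ 2 := by field_simp
        _ ≤ |w t| / (δ / 2) ^ 2 := by gcongr)
    ((hw.abs.div_const _).intervalIntegrable a b)
    (Filter.Eventually.of_forall fun t _ y hy =>
      hasFDerivAt_const_div_norm_sub (w t) (sub_ne_zero.1 (norm_ne_zero_iff.1 (hne y hy t))))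
  rw [hasGradientAt_iff_hasFDerivAt]
  refine key.congr_fderiv ?_
  ext v
  rw [ContinuousLinearMap.intervalIntegral_apply (hfderiv.intervalIntegrable a b),
    InnerProductSpace.toDual_apply_apply, real_inner_comm, ← innerSL_apply_apply ℝ,
    ← (innerSL ℝ v).intervalIntegral_comp_comm (hgrad.intervalIntegrable a b)]
  simp only [innerSL_apply_apply, real_inner_comm]

end InverseDistance


/-- The gradient of the electric potential of a charged knot is obtained by
differentiating under the integral sign; its negative is the electric field. -/
theorem gradient_potential_eq_integral
    (r : ℝ → EuclideanSpace ℝ (Fin 3))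
    (hr : ContDiff ℝ (⊤ : ℕ∞) r)
    (hper : Function.Periodic r (2 * Real.pi))
    (hinj : Set.InjOn r (Set.Ico 0 (2 * Real.pi)))
    (hr' : ∀ t, deriv r t ≠ 0)
    (K : Set (EuclideanSpace ℝ (Fin 3))) (hK : K = Set.range r)
    (Φ : EuclideanSpace ℝ (Fin 3) → ℝ)
    (hΦ : ∀ x, Φ x = ∫ t in (0:ℝ)..(2 * Real.pi), ‖deriv r t‖ / ‖x - r t‖)
    (x : EuclideanSpace ℝ (Fin 3)) (hx : x ∉ K) :
    gradient Φ x
      = ∫ t in (0:ℝ)..(2 * Real.pi), (‖deriv r t‖ / ‖x - r t‖ ^ 3) • (r t - x) := by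
  subst hK
  have hclosed : IsClosed (Set.range r) :=
    (hper.compact_of_continuous Real.two_pi_pos.ne' hr.continuous).isClosed
  obtain ⟨δ, hδ, hball⟩ := Metric.isOpen_iff.1 hclosed.isOpen_compl x hx
  have hdist : ∀ t, δ ≤ ‖x - r t‖ := fun t => by
    by_contra! h
    exact hball (by rwa [Metric.mem_ball, dist_comm, dist_eq_norm]) ⟨t, rfl⟩
  rw [funext hΦ]
  exact (hasGradientAt_integral_div_norm_sub hr.continuous
    (hr.continuous_deriv (by simp)).norm hδ hdist).gradient
end

section
/- First-order asymptotics of the potential at infinity: the function x ↦ ‖x‖ * Φ(x) tends to L along the cocompact filter on EuclideanSpace ℝ (Fin 3), where L = ∫ t in 0..2π, ‖deriv r t‖ is the total length of the knot; that is, at infinity the knot's potential agrees to first order with that of a point charge of total charge L. -/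
/-- Translating by a fixed vector does not change the norm to first order at infinity. -/
theorem tendsto_norm_div_norm_sub_cobounded {E : Type*} [NormedAddCommGroup E] (y : E) :
    Filter.Tendsto (fun x : E => ‖x‖ / ‖x - y‖) (Bornology.cobounded E) (nhds 1) := by
  have hlow : Filter.Tendsto (fun x : E => ‖x‖ - ‖y‖) (Bornology.cobounded E) Filter.atTop :=
    Filter.tendsto_atTop_add_const_right _ (-‖y‖) tendsto_norm_cobounded_atTop
  have hsub : Filter.Tendsto (fun x : E => ‖x - y‖) (Bornology.cobounded E) Filter.atTop :=
    Filter.tendsto_atTop_mono (fun x => norm_sub_norm_le x y) hlow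
  rw [tendsto_iff_norm_sub_tendsto_zero]
  refine squeeze_zero' (Filter.Eventually.of_forall fun _ => norm_nonneg _) ?_
    (hsub.const_div_atTop ‖y‖)
  filter_upwards [hsub.eventually_gt_atTop 0] with x hx
  rw [div_sub_one hx.ne', norm_div, norm_norm, Real.norm_eq_abs]
  gcongr
  simpa using abs_norm_sub_norm_le x (x - y)

/-- A point at least twice as far out as `y` has norm at most twice its distance to `y`. -/
theorem norm_div_norm_sub_le_two {E : Type*} [NormedAddCommGroup E] {x y : E}
    (h : 2 * ‖y‖ ≤ ‖x‖) : ‖x‖ / ‖x - y‖ ≤ 2 := by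
  refine div_le_of_le_mul₀ (norm_nonneg _) zero_le_two ?_
  linarith [norm_sub_norm_le x y]

/-- First-order asymptotics at infinity: `‖x‖ * Φ x → L`, the total length
(total charge) of the knot, along the cocompact filter. -/
theorem potential_asymptotics_at_infinity
    (r : ℝ → EuclideanSpace ℝ (Fin 3))
    (hr : ContDiff ℝ (⊤ : ℕ∞) r)
    (hper : Function.Periodic r (2 * Real.pi))
    (hinj : Set.InjOn r (Set.Ico 0 (2 * Real.pi)))
    (hr' : ∀ t, deriv r t ≠ 0)
    (K : Set (EuclideanSpace ℝ (Fin 3))) (hK : K = Set.range r)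
    (Φ : EuclideanSpace ℝ (Fin 3) → ℝ)
    (hΦ : ∀ x, Φ x = ∫ t in (0:ℝ)..(2 * Real.pi), ‖deriv r t‖ / ‖x - r t‖)
    (L : ℝ) (hL : L = ∫ t in (0:ℝ)..(2 * Real.pi), ‖deriv r t‖) :
    Filter.Tendsto (fun x => ‖x‖ * Φ x)
      (Filter.cocompact (EuclideanSpace ℝ (Fin 3))) (nhds L) := by
  subst hL
  simp only [hΦ, ← intervalIntegral.integral_const_mul]
  have hcr : Continuous r := hr.continuous
  have hcd : Continuous (deriv r) := hr.continuous_deriv (by simp)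
  obtain ⟨M, hM⟩ := (isCompact_uIcc (a := (0 : ℝ)) (b := 2 * Real.pi)).exists_bound_of_continuousOn
    hcr.continuousOn
  rw [← Metric.cobounded_eq_cocompact]
  have : (Bornology.cobounded (EuclideanSpace ℝ (Fin 3))).IsCountablyGenerated := by
    rw [← comap_norm_atTop]
    infer_instance
  refine intervalIntegral.tendsto_integral_filter_of_dominated_convergence
    (fun t => 2 * ‖deriv r t‖) (Filter.Eventually.of_forall fun x => ?_) ?_
    ((hcd.norm.const_mul 2).intervalIntegrable _ _) (Filter.Eventually.of_forall fun t _ => ?_)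
  · exact Measurable.aestronglyMeasurable (measurable_const.mul
      (hcd.norm.measurable.div (continuous_const.sub hcr).norm.measurable))
  · filter_upwards [tendsto_norm_cobounded_atTop.eventually_ge_atTop (2 * M)] with x hx
    refine Filter.Eventually.of_forall fun t ht => ?_
    have hle : ‖x‖ / ‖x - r t‖ ≤ 2 :=
      norm_div_norm_sub_le_two (by linarith [hM t (Set.uIoc_subset_uIcc ht)])
    rw [Real.norm_of_nonneg (by positivity), mul_div_left_comm, mul_comm]
    gcongr
  · simpa [mul_div_left_comm] using
      (tendsto_norm_div_norm_sub_cobounded (r t)).const_mul ‖deriv r t‖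
end

section
/- The electric potential blows up near the knot: for every M > 0 there exists δ > 0 such that for all x ∉ K with Metric.infDist x K < δ, one has Φ(x) > M. -/
open MeasureTheory in
/-- A lower bound for the potential of a closed curve in terms of the distance to any of its points,
given two-sided bounds on the speed. -/
theorem log_le_integral_speed_div_dist {E : Type*} [NormedAddCommGroup E] [NormedSpace ℝ E]
    {r : ℝ → E} {T c L : ℝ} (hr : ContDiff ℝ 1 r) (hper : Function.Periodic r T) (hT : 0 < T)
    (hL0 : 0 < L) (hc : ∀ t, c ≤ ‖deriv r t‖) (hL : ∀ t, ‖deriv r t‖ ≤ L)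
    {x : E} (hx : x ∉ Set.range r) (s : ℝ) :
    c / L * Real.log ((‖x - r s‖ + L * T) / ‖x - r s‖) ≤
      ∫ t in (0 : ℝ)..T, ‖deriv r t‖ / ‖x - r t‖ := by
  have hne : ∀ t, 0 < ‖x - r t‖ := fun t =>
    norm_pos_iff.2 (sub_ne_zero.2 fun h => hx ⟨t, h.symm⟩)
  set d := ‖x - r s‖
  have hd0 : 0 < d := hne s
  have hder : Function.Periodic (deriv r) T := fun t => by
    rw [← deriv_comp_add_const, show (fun u => r (u + T)) = r from funext hper]
  have hshift : ∫ t in (0 : ℝ)..T, ‖deriv r t‖ / ‖x - r t‖ =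
      ∫ t in s..s + T, ‖deriv r t‖ / ‖x - r t‖ := by
    have hp : Function.Periodic (fun t => ‖deriv r t‖ / ‖x - r t‖) T := fun t => by
      simp only [hder t, hper t]
    simpa using hp.intervalIntegral_add_eq 0 s
  have hpos : ∀ t ∈ Set.uIcc s (s + T), 0 < d + L * (t - s) := fun t ht => by
    rw [Set.uIcc_of_le (by linarith)] at ht
    have := mul_nonneg hL0.le (sub_nonneg.2 ht.1)
    linarith
  have hint : IntervalIntegrable (fun t => c / (d + L * (t - s))) volume s (s + T) := by
    refine ContinuousOn.intervalIntegrable (ContinuousOn.div (by fun_prop) (by fun_prop) ?_)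
    exact fun t ht => (hpos t ht).ne'
  have hval : ∫ t in s..s + T, c / (d + L * (t - s)) = c / L * Real.log ((d + L * T) / d) := by
    rw [intervalIntegral.integral_eq_sub_of_hasDerivAt
      (f := fun t => c / L * Real.log (d + L * (t - s))) (fun t ht => ?_) hint]
    · rw [Real.log_div (by positivity) hd0.ne']
      simp [mul_sub]
    · have h1 : HasDerivAt (fun t => d + L * (t - s)) L t := by
        simpa using (((hasDerivAt_id t).sub_const s).const_mul L).const_add d
      have heq : c / L * (L / (d + L * (t - s))) = c / (d + L * (t - s)) := by
        rw [← mul_div_assoc, div_mul_cancel₀ c hL0.ne']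
      exact heq ▸ (h1.log (hpos t ht).ne').const_mul (c / L)
  rw [hshift, ← hval]
  refine intervalIntegral.integral_mono_on (by linarith) hint ?_ fun t ht => ?_
  · refine Continuous.intervalIntegrable ?_ _ _
    have := hr.continuous_deriv le_rfl
    have := hr.continuous
    exact Continuous.div (by fun_prop) (by fun_prop) fun t => (hne t).ne'
  · have hlip : ‖r t - r s‖ ≤ L * (t - s) := by
      have := convex_univ.norm_image_sub_le_of_norm_deriv_le (𝕜 := ℝ) (f := r) (C := L)
        (fun y _ => (hr.differentiable one_ne_zero) y) (fun y _ => hL y)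
        (Set.mem_univ s) (Set.mem_univ t)
      rwa [Real.norm_eq_abs, abs_of_nonneg (sub_nonneg.2 ht.1)] at this
    have htri : ‖x - r t‖ ≤ d + L * (t - s) := by
      have := norm_sub_le_norm_sub_add_norm_sub x (r s) (r t)
      rw [norm_sub_rev (r s)] at this
      linarith
    exact div_le_div₀ (norm_nonneg _) (hc t) (hne t) htri

/-- The electric potential blows up near the knot. -/
theorem potential_blows_up_near_knot
    (r : ℝ → EuclideanSpace ℝ (Fin 3))
    (hr : ContDiff ℝ (⊤ : ℕ∞) r)
    (hper : Function.Periodic r (2 * Real.pi))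
    (hinj : Set.InjOn r (Set.Ico 0 (2 * Real.pi)))
    (hr' : ∀ t, deriv r t ≠ 0)
    (K : Set (EuclideanSpace ℝ (Fin 3))) (hK : K = Set.range r)
    (Φ : EuclideanSpace ℝ (Fin 3) → ℝ)
    (hΦ : ∀ x, Φ x = ∫ t in (0:ℝ)..(2 * Real.pi), ‖deriv r t‖ / ‖x - r t‖)
    (M : ℝ) (hM : 0 < M) :
    ∃ δ > 0, ∀ x ∉ K, Metric.infDist x K < δ → Φ x > M := by
  have hT : 0 < 2 * Real.pi := Real.two_pi_pos
  have hr1 : ContDiff ℝ 1 r := hr.of_le (by exact_mod_cast le_top)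
  have hcont : Continuous fun t => ‖deriv r t‖ := (hr1.continuous_deriv le_rfl).norm
  have hder : Function.Periodic (fun t => ‖deriv r t‖) (2 * Real.pi) := fun t => by
    beta_reduce
    rw [← deriv_comp_add_const, show (fun u => r (u + 2 * Real.pi)) = r from funext hper]
  have hne : (Set.Icc 0 (2 * Real.pi)).Nonempty := Set.nonempty_Icc.2 hT.le
  obtain ⟨a, -, ha⟩ := isCompact_Icc.exists_isMinOn hne hcont.continuousOn
  obtain ⟨b, -, hb⟩ := isCompact_Icc.exists_isMaxOn hne hcont.continuousOn
  have hc : ∀ t, ‖deriv r a‖ ≤ ‖deriv r t‖ := fun t => by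
    obtain ⟨u, hu, h⟩ := hder.exists_mem_Ico₀ hT t
    exact (ha (Set.Ico_subset_Icc_self hu)).trans_eq h.symm
  have hL : ∀ t, ‖deriv r t‖ ≤ ‖deriv r b‖ := fun t => by
    obtain ⟨u, hu, h⟩ := hder.exists_mem_Ico₀ hT t
    exact h.trans_le (hb (Set.Ico_subset_Icc_self hu))
  have hc0 : 0 < ‖deriv r a‖ := norm_pos_iff.2 (hr' a)
  have hL0 : 0 < ‖deriv r b‖ := norm_pos_iff.2 (hr' b)
  set c := ‖deriv r a‖
  set L := ‖deriv r b‖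
  refine ⟨L * (2 * Real.pi) / Real.exp (M * L / c), by positivity, fun x hx hxK => ?_⟩
  subst hK
  obtain ⟨_, ⟨s, rfl⟩, hs⟩ := (Metric.infDist_lt_iff (Set.range_nonempty r)).1 hxK
  rw [dist_eq_norm] at hs
  have hd0 : 0 < ‖x - r s‖ := norm_pos_iff.2 (sub_ne_zero.2 fun h => hx ⟨s, h.symm⟩)
  rw [hΦ]
  refine lt_of_lt_of_le ?_ (log_le_integral_speed_div_dist hr1 hper hT hL0 hc hL hx s)
  have hlog : M * L / c < Real.log ((‖x - r s‖ + L * (2 * Real.pi)) / ‖x - r s‖) := by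
    rw [Real.lt_log_iff_exp_lt (by positivity), lt_div_iff₀ hd0]
    rw [lt_div_iff₀ (Real.exp_pos _)] at hs
    linarith
  calc M = c / L * (M * L / c) := by field_simp
    _ < _ := mul_lt_mul_of_pos_left hlog (by positivity)
end

section
/- Properness of the potential: for every c > 0, the set K ∪ {x ∈ EuclideanSpace ℝ (Fin 3) | x ∉ K ∧ Φ(x) ≥ c} is compact. (Equivalently, Φ is a proper function on the knot complement in S³ once extended by Φ(∞) = 0.) -/
/-- The potential of a curve of speed at most `M` contained in the ball of radius `R` decays
at infinity. -/
theorem potential_le_div_of_bounds {E : Type*} [NormedAddCommGroup E] {r v : ℝ → E} {x : E}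
    {R M T : ℝ} (hT : 0 ≤ T) (hR : ∀ t, ‖r t‖ ≤ R) (hM : ∀ t, ‖v t‖ ≤ M) (hx : R < ‖x‖) :
    ∫ t in (0:ℝ)..T, ‖v t‖ / ‖x - r t‖ ≤ M / (‖x‖ - R) * T := by
  have hb : ∀ t ∈ Set.uIoc 0 T, ‖‖v t‖ / ‖x - r t‖‖ ≤ M / (‖x‖ - R) := by
    intro t _
    rw [Real.norm_of_nonneg (by positivity)]
    have h1 : ‖x‖ - R ≤ ‖x - r t‖ := by
      linarith [norm_sub_norm_le x (r t), hR t]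
    exact div_le_div₀ ((norm_nonneg _).trans (hM t)) (hM t) (by linarith) h1
  have h := intervalIntegral.norm_integral_le_of_norm_le_const hb
  rw [sub_zero, abs_of_nonneg hT] at h
  exact (Real.le_norm_self _).trans h

/-- The potential of a curve is continuous off the curve. -/
theorem continuousOn_potential_compl_range {E : Type*} [NormedAddCommGroup E] {r v : ℝ → E}
    (hr : Continuous r) (hv : Continuous v) (T : ℝ) :
    ContinuousOn (fun x => ∫ t in (0:ℝ)..T, ‖v t‖ / ‖x - r t‖) (Set.range r)ᶜ := by
  rw [continuousOn_iff_continuous_domRestrict]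
  apply intervalIntegral.continuous_parametric_intervalIntegral_of_continuous'
    (f := fun (x : ((Set.range r)ᶜ : Set E)) t => ‖v t‖ / ‖(x : E) - r t‖)
  refine Continuous.div (by fun_prop) (by fun_prop) ?_
  rintro ⟨⟨x, hx⟩, t⟩ h
  exact hx ⟨t, (sub_eq_zero.1 (norm_eq_zero.1 h)).symm⟩


/-- Properness of the potential: every superlevel set, together with the knot,
is compact. -/
theorem potential_proper
    (r : ℝ → EuclideanSpace ℝ (Fin 3))
    (hr : ContDiff ℝ (⊤ : ℕ∞) r)
    (hper : Function.Periodic r (2 * Real.pi))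
    (hinj : Set.InjOn r (Set.Ico 0 (2 * Real.pi)))
    (hr' : ∀ t, deriv r t ≠ 0)
    (K : Set (EuclideanSpace ℝ (Fin 3))) (hK : K = Set.range r)
    (Φ : EuclideanSpace ℝ (Fin 3) → ℝ)
    (hΦ : ∀ x, Φ x = ∫ t in (0:ℝ)..(2 * Real.pi), ‖deriv r t‖ / ‖x - r t‖)
    (c : ℝ) (hc : 0 < c) :
    IsCompact (K ∪ {x : EuclideanSpace ℝ (Fin 3) | x ∉ K ∧ Φ x ≥ c}) := by
  obtain rfl : Φ = _ := funext hΦ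
  subst hK
  have hv : Continuous (deriv r) := hr.continuous_deriv (by simp)
  have hperv : Function.Periodic (deriv r) (2 * Real.pi) := fun t => by
    rw [← deriv_comp_add_const]
    exact congrArg (fun f => deriv f t) (funext hper)
  have hKc : IsCompact (Set.range r) := hper.compact_of_continuous
    Real.two_pi_pos.ne' hr.continuous
  obtain ⟨R, hR⟩ := hKc.isBounded.exists_norm_le
  obtain ⟨M, hM⟩ := (hperv.compact_of_continuous
    Real.two_pi_pos.ne' hv).isBounded.exists_norm_le
  rw [Set.forall_mem_range] at hR hM
  refine Metric.isCompact_of_isClosed_isBounded ?_ (hKc.isBounded.union ?_)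
  · have h := (continuousOn_potential_compl_range hr.continuous hv
      (2 * Real.pi)).isOpen_inter_preimage hKc.isClosed.isOpen_compl (isOpen_Iio (a := c))
    convert h.isClosed_compl using 1
    ext x
    simp only [Set.mem_union, Set.mem_ofPred_eq, Set.mem_compl_iff, Set.mem_inter_iff,
      Set.mem_preimage, Set.mem_Iio, ge_iff_le, ← not_lt]
    tauto
  · rw [isBounded_iff_forall_norm_le]
    refine ⟨R + M * (2 * Real.pi) / c, ?_⟩
    rintro x ⟨-, hx⟩
    have hM0 : 0 ≤ M := (norm_nonneg _).trans (hM 0)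
    rcases le_or_gt ‖x‖ R with h | h
    · have : 0 ≤ M * (2 * Real.pi) / c := by positivity
      linarith
    · have h1 := le_trans hx (potential_le_div_of_bounds Real.two_pi_pos.le hR hM h)
      rw [div_mul_eq_mul_div, le_div_iff₀ (sub_pos.2 h)] at h1
      have h2 : ‖x‖ - R ≤ M * (2 * Real.pi) / c := by
        rw [le_div_iff₀ hc]
        linarith
      linarith
end

section
/- The electric potential has no local extrema off the knot: for every x ∉ K, Φ does not have a local maximum at x and does not have a local minimum at x (in the sense of IsLocalMax and IsLocalMin on EuclideanSpace ℝ (Fin 3) \ K). -/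
open MeasureTheory Set Metric Filter Topology

lemma integral_radial_cap {a R : ℝ} (ha : 0 < a) :
    ∫ s in (0:ℝ)..R, s * (√(a ^ 2 + s ^ 2))⁻¹ = √(a ^ 2 + R ^ 2) - a := by
  have hd : ∀ s ∈ uIcc 0 R, HasDerivAt (fun s => √(a ^ 2 + s ^ 2)) (s * (√(a ^ 2 + s ^ 2))⁻¹) s := by
    intro s _
    have hpos : 0 < a ^ 2 + s ^ 2 := by positivity
    have h := (((hasDerivAt_id s).pow 2).const_add (a ^ 2)).sqrt hpos.ne'
    refine HasDerivAt.congr_deriv h ?_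
    have hs := Real.sqrt_pos.2 hpos
    simp only [id, Pi.pow_apply]
    generalize √(a ^ 2 + s ^ 2) = q at hs
    field_simp
    norm_num
  rw [intervalIntegral.integral_eq_sub_of_hasDerivAt hd]
  · simp [Real.sqrt_sq ha.le]
  · apply ContinuousOn.intervalIntegrable
    apply Continuous.continuousOn
    have : ∀ s : ℝ, √(a ^ 2 + s ^ 2) ≠ 0 := fun s => by positivity
    fun_prop (disch := assumption)

lemma integral_sqrt_affine_sub {W ρ : ℝ} (hρ : 0 < ρ) (h : ρ < W) :
    ∫ p in (-ρ)..ρ, (√(W ^ 2 + 2 * W * p + ρ ^ 2) - (W + p)) = 2 * ρ ^ 3 / (3 * W) := by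
  have hW : 0 < W := hρ.trans h
  have hd : ∀ p ∈ Ioo (-ρ) ρ, HasDerivAt
      (fun p => √(W ^ 2 + 2 * W * p + ρ ^ 2) ^ 3 / (3 * W) - (W * p + p ^ 2 / 2))
      (√(W ^ 2 + 2 * W * p + ρ ^ 2) - (W + p)) p := by
    intro p hp
    have hpos : 0 < W ^ 2 + 2 * W * p + ρ ^ 2 := by nlinarith [hp.1, hp.2]
    have hs := Real.sqrt_pos.2 hpos
    have h1 := (((((hasDerivAt_id p).const_mul (2 * W)).const_add (W ^ 2)).add_const
      (ρ ^ 2)).sqrt hpos.ne').pow 3 |>.div_const (3 * W)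
    have h2 := ((hasDerivAt_id p).const_mul W).add (((hasDerivAt_id p).pow 2).div_const 2)
    refine HasDerivAt.congr_deriv (h1.sub h2) ?_
    simp only [id]
    generalize √(W ^ 2 + 2 * W * p + ρ ^ 2) = q at hs
    field_simp
    norm_num
    ring
  have hc : Continuous (fun p => √(W ^ 2 + 2 * W * p + ρ ^ 2) ^ 3 / (3 * W) - (W * p + p ^ 2 / 2)) := by
    fun_prop
  rw [intervalIntegral.integral_eq_sub_of_hasDerivAt_of_le (by linarith) hc.continuousOn hd
    (Continuous.intervalIntegrable (by fun_prop) _ _)]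
  rw [show W ^ 2 + 2 * W * ρ + ρ ^ 2 = (W + ρ) ^ 2 by ring,
    show W ^ 2 + 2 * W * -ρ + ρ ^ 2 = (W - ρ) ^ 2 by ring,
    Real.sqrt_sq (by linarith), Real.sqrt_sq (by linarith)]
  field_simp
  ring

lemma norm_toLp_real_complex (p : ℝ) (z : ℂ) :
    ‖WithLp.toLp 2 (p, z)‖ = √(p ^ 2 + ‖z‖ ^ 2) := by
  simp [WithLp.prod_norm_eq_of_L2]

lemma integral_slice {W ρ : ℝ} (hρ : 0 < ρ) (h : ρ < W) (p : ℝ) :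
    ∫ z : ℂ, (if √(p ^ 2 + ‖z‖ ^ 2) < ρ then (√((W + p) ^ 2 + ‖z‖ ^ 2))⁻¹ else 0) =
      (Ioc (-ρ) ρ).indicator
        (fun p => 2 * Real.pi * (√(W ^ 2 + 2 * W * p + ρ ^ 2) - (W + p))) p := by
  rw [integral_fun_norm_addHaar volume
    (fun s => if √(p ^ 2 + s ^ 2) < ρ then (√((W + p) ^ 2 + s ^ 2))⁻¹ else 0)]
  have hvol : (volume : Measure ℂ).real (ball 0 1) = Real.pi := by
    simp [Measure.real, Complex.volume_ball]
  rw [hvol, Complex.finrank_real_complex]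
  simp only [smul_eq_mul, nsmul_eq_mul, Nat.cast_ofNat, Nat.add_one_sub_one, pow_one]
  by_cases hp : p ^ 2 < ρ ^ 2
  · have hp' := abs_lt_of_sq_lt_sq' hp hρ.le
    rw [indicator_of_mem (show p ∈ Ioc (-ρ) ρ from ⟨hp'.1, hp'.2.le⟩), mul_assoc]
    congr 2
    set R := √(ρ ^ 2 - p ^ 2) with hR
    have hR2 : R ^ 2 = ρ ^ 2 - p ^ 2 := Real.sq_sqrt (by linarith)
    have hRpos : 0 < R := Real.sqrt_pos.2 (by linarith)
    have hiff : ∀ s ∈ Ioi (0:ℝ), (√(p ^ 2 + s ^ 2) < ρ ↔ s ∈ Ioo 0 R) := by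
      intro s hs
      rw [Real.sqrt_lt' hρ]
      simp only [mem_Ioi] at hs
      constructor
      · intro h1
        exact ⟨hs, lt_of_pow_lt_pow_left₀ 2 hRpos.le (by linarith)⟩
      · intro h1
        nlinarith [h1.2]
    have := integral_radial_cap (a := W + p) (R := R) (by linarith)
    rw [show W ^ 2 + 2 * W * p + ρ ^ 2 = (W + p) ^ 2 + R ^ 2 by rw [hR2]; ring, ← this,
      intervalIntegral.integral_of_le hRpos.le, integral_Ioc_eq_integral_Ioo,
      ← integral_indicator measurableSet_Ioo, ← integral_indicator measurableSet_Ioi]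
    congr 1 with s
    by_cases hs : s ∈ Ioi (0:ℝ)
    · rw [indicator_of_mem hs]
      by_cases h2 : s ∈ Ioo 0 R
      · rw [indicator_of_mem h2, if_pos ((hiff s hs).2 h2)]
      · rw [indicator_of_notMem h2, if_neg (fun h3 => h2 ((hiff s hs).1 h3)), mul_zero]
    · rw [indicator_of_notMem hs, indicator_of_notMem (fun h3 => hs h3.1)]
  · have h0 : ∀ s : ℝ, ¬ (√(p ^ 2 + s ^ 2) < ρ) := by
      intro s hs
      rw [Real.sqrt_lt' hρ] at hs
      nlinarith [sq_nonneg s]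
    simp only [h0, if_false, mul_zero, integral_zero]
    by_cases hm : p ∈ Ioc (-ρ) ρ
    · have hpe : p = ρ := by
        by_contra hne
        exact hp (sq_lt_sq' hm.1 (lt_of_le_of_ne hm.2 hne))
      rw [indicator_of_mem hm, hpe, show W ^ 2 + 2 * W * ρ + ρ ^ 2 = (W + ρ) ^ 2 by ring,
        Real.sqrt_sq (by linarith)]
      ring
    · rw [indicator_of_notMem hm]

lemma integrable_ball_inv_norm_add {V : Type*} [NormedAddCommGroup V] [MeasurableSpace V]
    [BorelSpace V] {μ : Measure V} {w : V} {ρ : ℝ} (hfin : μ (ball 0 ρ) ≠ ⊤) (h : ρ < ‖w‖) :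
    Integrable (fun y : V => if ‖y‖ < ρ then ‖w + y‖⁻¹ else 0) μ := by
  have : (fun y : V => if ‖y‖ < ρ then ‖w + y‖⁻¹ else 0) =
      (ball (0:V) ρ).indicator (fun y => ‖w + y‖⁻¹) := by
    ext y; simp [indicator]
  rw [this, integrable_indicator_iff measurableSet_ball]
  refine IntegrableOn.of_bound hfin.lt_top ?_ (‖w‖ - ρ)⁻¹ ?_
  · exact Measurable.aestronglyMeasurable (by fun_prop)
  · filter_upwards [ae_restrict_mem measurableSet_ball] with y hy
    rw [norm_inv, norm_norm]
    have := norm_sub_le (w + y) y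
    rw [mem_ball_zero_iff] at hy
    rw [add_sub_cancel_right] at this
    exact inv_anti₀ (by linarith) (by linarith)

lemma integral_ball_inv_norm_axis {W ρ : ℝ} (hρ : 0 < ρ) (h : ρ < W) :
    ∫ y : WithLp 2 (ℝ × ℂ), (if ‖y‖ < ρ then ‖WithLp.toLp 2 (W, (0:ℂ)) + y‖⁻¹ else 0) =
      Real.pi * 4 / 3 * ρ ^ 3 * W⁻¹ := by
  have hW : 0 < W := hρ.trans h
  have hmp := WithLp.volume_preserving_toLp ℝ ℂ
  have hemb : MeasurableEmbedding (@WithLp.toLp 2 (ℝ × ℂ)) :=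
    (MeasurableEquiv.toLp 2 (ℝ × ℂ)).measurableEmbedding
  have hint : Integrable
      (fun y : WithLp 2 (ℝ × ℂ) => if ‖y‖ < ρ then ‖WithLp.toLp 2 (W, (0:ℂ)) + y‖⁻¹ else 0) := by
    apply integrable_ball_inv_norm_add measure_ball_lt_top.ne
    rw [norm_toLp_real_complex]
    simpa [Real.sqrt_sq hW.le] using h
  rw [← hmp.integrable_comp_emb hemb] at hint
  rw [← hmp.integral_comp hemb]
  rw [Measure.volume_eq_prod] at hint ⊢
  have key : ∀ (p : ℝ) (z : ℂ), (if ‖WithLp.toLp 2 (p, z)‖ < ρ then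
      ‖WithLp.toLp 2 (W, (0:ℂ)) + WithLp.toLp 2 (p, z)‖⁻¹ else 0) =
      if √(p ^ 2 + ‖z‖ ^ 2) < ρ then (√((W + p) ^ 2 + ‖z‖ ^ 2))⁻¹ else 0 := by
    intro p z
    rw [← WithLp.toLp_add, Prod.mk_add_mk, zero_add, norm_toLp_real_complex,
      norm_toLp_real_complex]
  refine (integral_prod _ hint).trans ?_
  simp only [Function.comp_apply]
  simp only [key, integral_slice hρ h]
  rw [integral_indicator measurableSet_Ioc, ← intervalIntegral.integral_of_le (by linarith),
    intervalIntegral.integral_const_mul, integral_sqrt_affine_sub hρ h]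
  field_simp
  ring

lemma integral_ball_inv_norm_add {w : EuclideanSpace ℝ (Fin 3)} {ρ : ℝ} (hρ : 0 < ρ)
    (h : ρ < ‖w‖) :
    ∫ y in ball (0 : EuclideanSpace ℝ (Fin 3)) ρ, ‖w + y‖⁻¹ =
      volume.real (ball (0 : EuclideanSpace ℝ (Fin 3)) ρ) * ‖w‖⁻¹ := by
  have hvol : volume.real (ball (0 : EuclideanSpace ℝ (Fin 3)) ρ) = Real.pi * 4 / 3 * ρ ^ 3 := by
    rw [Measure.real, EuclideanSpace.volume_ball_fin_three, ENNReal.toReal_mul, ENNReal.toReal_pow,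
      ENNReal.toReal_ofReal hρ.le, ENNReal.toReal_ofReal (by positivity)]
    ring
  have hrank : Module.finrank ℝ (EuclideanSpace ℝ (Fin 3)) =
      Module.finrank ℝ (WithLp 2 (ℝ × ℂ)) := by
    rw [(WithLp.linearEquiv 2 ℝ (ℝ × ℂ)).finrank_eq]
    simp
  let φ : EuclideanSpace ℝ (Fin 3) ≃ₗᵢ[ℝ] WithLp 2 (ℝ × ℂ) :=
    ((stdOrthonormalBasis ℝ _).reindex (finCongr hrank)).equiv (stdOrthonormalBasis ℝ _) (Equiv.refl _)
  have hnorm : ‖φ w‖ = ‖WithLp.toLp 2 (‖w‖, (0:ℂ))‖ := by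
    rw [norm_toLp_real_complex ‖w‖, φ.norm_map]; simp
  let ψ := φ.trans (Submodule.reflection (ℝ ∙ (φ w - WithLp.toLp 2 (‖w‖, (0:ℂ))))ᗮ)
  have hψ : ψ w = WithLp.toLp 2 (‖w‖, (0:ℂ)) := Submodule.reflection_sub hnorm
  rw [hvol, ← integral_ball_inv_norm_axis hρ h, ← hψ, ← ψ.measurePreserving.integral_comp
    ψ.toHomeomorph.measurableEmbedding, ← integral_indicator measurableSet_ball]
  congr 1 with y
  simp only [indicator, mem_ball_zero_iff, ψ.norm_map, ← map_add]

/-- The Newtonian potential at `x` of the charge density `σ` along the curve `r` over `[a, b]`. -/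
noncomputable def curvePotential (r : ℝ → EuclideanSpace ℝ (Fin 3)) (σ : ℝ → ℝ) (a b : ℝ)
    (x : EuclideanSpace ℝ (Fin 3)) : ℝ :=
  ∫ t in a..b, σ t / ‖x - r t‖

section Potential

variable {r : ℝ → EuclideanSpace ℝ (Fin 3)} {σ : ℝ → ℝ} {a b ρ D : ℝ}
  {x : EuclideanSpace ℝ (Fin 3)}

lemma continuousOn_curvePotential (hr : Continuous r) (hσ : Continuous σ) (hρD : ρ < D)
    (hD : ∀ t, D ≤ ‖x - r t‖) : ContinuousOn (curvePotential r σ a b) (ball x ρ) := by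
  have hne : ∀ p : EuclideanSpace ℝ (Fin 3) × ℝ, max ‖p.1 - r p.2‖ (D - ρ) ≠ 0 := fun p =>
    (lt_max_of_lt_right (sub_pos.2 hρD)).ne'
  have hc : Continuous fun y => ∫ t in a..b, σ t / max ‖y - r t‖ (D - ρ) := by
    apply intervalIntegral.continuous_parametric_intervalIntegral_of_continuous'
    simp only [Function.uncurry_def]
    exact Continuous.div (by fun_prop) (by fun_prop) hne
  refine hc.continuousOn.congr fun y hy => ?_
  refine intervalIntegral.integral_congr fun t _ => ?_
  have h1 : ‖x - y‖ < ρ := by rwa [mem_ball', dist_eq_norm] at hy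
  have h2 := norm_sub_le_norm_sub_add_norm_sub x y (r t)
  have h3 := hD t
  rw [max_eq_left (by linarith)]

lemma integral_ball_curvePotential (hr : Continuous r) (hσ : Continuous σ) (hab : a ≤ b)
    (hρ : 0 < ρ) (hρD : ρ < D) (hD : ∀ t, D ≤ ‖x - r t‖) :
    ∫ y in ball (0 : EuclideanSpace ℝ (Fin 3)) ρ, curvePotential r σ a b (x + y) =
      volume.real (ball (0 : EuclideanSpace ℝ (Fin 3)) ρ) * curvePotential r σ a b x := by
  have : IsFiniteMeasure (volume.restrict (ball (0 : EuclideanSpace ℝ (Fin 3)) ρ)) :=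
    by
    refine ⟨?_⟩
    rw [Measure.restrict_apply_univ]
    exact measure_ball_lt_top
  obtain ⟨C, hC⟩ := isCompact_Icc.exists_bound_of_continuousOn (s := Icc a b) hσ.continuousOn
  have hint : Integrable (Function.uncurry fun (y : EuclideanSpace ℝ (Fin 3)) t =>
      σ t / ‖x + y - r t‖) ((volume.restrict (ball 0 ρ)).prod (volume.restrict (Ioc a b))) := by
    refine Integrable.of_bound ?_ (C / (D - ρ)) ?_
    · apply Measurable.aestronglyMeasurable
      have h1 := hσ.measurable
      have h2 := hr.measurable
      simp only [Function.uncurry_def]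
      fun_prop
    · rw [Measure.prod_restrict]
      filter_upwards [ae_restrict_mem (measurableSet_ball.prod measurableSet_Ioc)] with p hp
      have h1 : ‖p.1‖ < ρ := by simpa using hp.1
      have h2 := hC p.2 (Ioc_subset_Icc_self hp.2)
      have h3 : D - ρ ≤ ‖x + p.1 - r p.2‖ := by
        have h4 := norm_sub_le (x + p.1 - r p.2) p.1
        rw [show x + p.1 - r p.2 - p.1 = x - r p.2 by abel] at h4
        linarith [hD p.2]
      rw [Function.uncurry, norm_div, norm_norm]
      exact div_le_div₀ ((norm_nonneg _).trans h2) h2 (sub_pos.2 hρD) h3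
  simp only [curvePotential, intervalIntegral.integral_of_le hab]
  rw [integral_integral_swap hint, ← integral_const_mul]
  refine integral_congr_ae (Eventually.of_forall fun t => ?_)
  have := integral_ball_inv_norm_add hρ (hρD.trans_le (hD t))
  simp only [div_eq_mul_inv]
  rw [integral_const_mul]
  simp only [show ∀ y, x + y - r t = x - r t + y from fun y => by abel]
  rw [this]
  ring

lemma curvePotential_eqOn_ball_of_le (hr : Continuous r) (hσ : Continuous σ) (hab : a ≤ b)
    (hρ : 0 < ρ) (hρD : ρ < D) (hD : ∀ t, D ≤ ‖x - r t‖)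
    (hmax : ∀ y ∈ ball x ρ, curvePotential r σ a b y ≤ curvePotential r σ a b x) :
    ∀ y ∈ ball x ρ, curvePotential r σ a b y = curvePotential r σ a b x := by
  set Φ := curvePotential r σ a b with hΦ
  have hmem : ∀ y ∈ ball (0 : EuclideanSpace ℝ (Fin 3)) ρ, x + y ∈ ball x ρ := fun y hy => by
    simpa using hy
  obtain ⟨ρ', hρ', hρD'⟩ := exists_between hρD
  have hcont : ContinuousOn (fun y => Φ (x + y)) (closedBall 0 ρ) := by
    refine (continuousOn_curvePotential hr hσ hρD' hD).comp (by fun_prop) fun y hy => ?_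
    rw [mem_closedBall_zero_iff] at hy
    simpa using hy.trans_lt hρ'
  have hint : IntegrableOn (fun y => Φ (x + y)) (ball 0 ρ) :=
    (hcont.integrableOn_compact (isCompact_closedBall _ _)).mono_set ball_subset_closedBall
  have hconst : IntegrableOn (fun _ : EuclideanSpace ℝ (Fin 3) => Φ x) (ball 0 ρ) :=
    integrableOn_const measure_ball_lt_top.ne
  have hzero : ∫ y in ball (0 : EuclideanSpace ℝ (Fin 3)) ρ, (Φ x - Φ (x + y)) = 0 := by
    rw [integral_sub hconst hint, integral_ball_curvePotential hr hσ hab hρ hρD hD]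
    simp [hΦ]
  have hnonneg : 0 ≤ᵐ[volume.restrict (ball 0 ρ)] fun y => Φ x - Φ (x + y) := by
    filter_upwards [ae_restrict_mem measurableSet_ball] with y hy
    exact sub_nonneg.2 (hmax _ (hmem y hy))
  have heq := Measure.eqOn_open_of_ae_eq
    ((integral_eq_zero_iff_of_nonneg_ae hnonneg (hconst.sub hint)).1 hzero) isOpen_ball
    (continuousOn_const.sub (hcont.mono ball_subset_closedBall)) continuousOn_const
  intro y hy
  have := heq (show y - x ∈ ball (0 : EuclideanSpace ℝ (Fin 3)) ρ by
    simpa [dist_eq_norm] using hy)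
  simp only [Pi.zero_apply, add_sub_cancel] at this
  linarith

end Potential

lemma differentiableOn_intervalIntegral_of_continuousOn {F F' : ℂ → ℝ → ℂ} {U : Set ℂ}
    (hU : IsOpen U) (hF : ContinuousOn (Function.uncurry F) (U ×ˢ univ))
    (hF' : ContinuousOn (Function.uncurry F') (U ×ˢ univ))
    (hd : ∀ z ∈ U, ∀ t, HasDerivAt (fun z => F z t) (F' z t) z) (a b : ℝ) :
    DifferentiableOn ℂ (fun z => ∫ t in a..b, F z t) U := by
  intro z hz
  obtain ⟨ε, hε, hball⟩ := Metric.nhds_basis_closedBall.mem_iff.1 (hU.mem_nhds hz)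
  have hslice : ∀ {G : ℂ → ℝ → ℂ}, ContinuousOn (Function.uncurry G) (U ×ˢ univ) →
      ∀ w ∈ U, Continuous (G w) := fun hG w hw =>
    continuousOn_univ.1 (hG.comp (f := fun t : ℝ => (w, t)) (by fun_prop) fun t _ => ⟨hw, trivial⟩)
  obtain ⟨C, hC⟩ := ((isCompact_closedBall z ε).prod (isCompact_uIcc (a := a) (b := b)))
    |>.exists_bound_of_continuousOn (hF'.mono (prod_mono hball (subset_univ _)))
  refine (intervalIntegral.hasDerivAt_integral_of_dominated_loc_of_deriv_le (bound := fun _ => C)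
    (F := F) (F' := F') (closedBall_mem_nhds z hε) ?_ ?_ ?_ ?_ ?_ ?_).2.differentiableAt
      |>.differentiableWithinAt
  · filter_upwards [hU.mem_nhds hz] with w hw
    exact (hslice hF w hw).aestronglyMeasurable
  · exact (hslice hF z hz).intervalIntegrable _ _
  · exact (hslice hF' z hz).aestronglyMeasurable
  · exact Eventually.of_forall fun t ht w hw => hC (w, t) ⟨hw, uIoc_subset_uIcc ht⟩
  · exact intervalIntegrable_const
  · exact Eventually.of_forall fun t _ w hw => hd w (hball hw) t

/-- The diamond `|Re z| + |Im z| < 1` in the complex plane. -/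
def complexDiamond : Set ℂ := {z | |z.re| + |z.im| < 1}

lemma isOpen_complexDiamond : IsOpen complexDiamond :=
  isOpen_lt (by fun_prop) continuous_const

lemma convex_complexDiamond : Convex ℝ complexDiamond := by
  intro z hz w hw a b ha hb hab
  simp only [complexDiamond, mem_ofPred_eq] at hz hw ⊢
  simp only [Complex.add_re, Complex.add_im, Complex.real_smul, Complex.mul_re, Complex.mul_im,
    Complex.ofReal_re, Complex.ofReal_im, zero_mul, sub_zero, add_zero]
  have h1 := abs_add_le (a * z.re) (b * w.re)
  have h2 := abs_add_le (a * z.im) (b * w.im)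
  simp only [abs_mul, abs_of_nonneg ha, abs_of_nonneg hb] at h1 h2
  have h3 := convex_Iio (𝕜 := ℝ) (1 : ℝ) hz hw ha hb hab
  simp only [smul_eq_mul, mem_Iio] at h3
  linarith

lemma re_quadratic_pos {E : Type*} [NormedAddCommGroup E] [InnerProductSpace ℝ E] {w v : E}
    (hv : v ≠ 0) (h : ‖v‖ ≤ ‖w‖) {z : ℂ} (hz : z ∈ complexDiamond) :
    0 < ((‖w‖ ^ 2 : ℝ) + (2 * inner ℝ w v : ℝ) * z + (‖v‖ ^ 2 : ℝ) * z ^ 2 : ℂ).re := by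
  have hv0 : 0 < ‖v‖ := norm_pos_iff.2 hv
  have h1 : ((‖w‖ ^ 2 : ℝ) + (2 * inner ℝ w v : ℝ) * z + (‖v‖ ^ 2 : ℝ) * z ^ 2 : ℂ).re =
      ‖w + z.re • v‖ ^ 2 - (|z.im| * ‖v‖) ^ 2 := by
    rw [norm_add_sq_real, mul_pow, sq_abs, norm_smul, mul_pow, Real.norm_eq_abs, sq_abs,
      real_inner_smul_right]
    simp only [Complex.add_re, Complex.ofReal_re, sq z, Complex.mul_re, Complex.ofReal_im]
    ring
  have h2 : |z.im| * ‖v‖ < ‖w + z.re • v‖ := by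
    have h3 := norm_sub_le (w + z.re • v) (z.re • v)
    rw [add_sub_cancel_right, norm_smul, Real.norm_eq_abs] at h3
    have hz' : |z.re| + |z.im| < 1 := hz
    nlinarith
  rw [h1, sub_pos]
  exact pow_lt_pow_left₀ h2 (by positivity) two_ne_zero

lemma quadratic_cpow_ofReal {E : Type*} [NormedAddCommGroup E] [InnerProductSpace ℝ E] (w v : E)
    (s : ℝ) :
    ((‖w‖ ^ 2 : ℝ) + (2 * inner ℝ w v : ℝ) * s + (‖v‖ ^ 2 : ℝ) * s ^ 2 : ℂ) ^ (-(1 / 2) : ℂ) =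
      (‖w + s • v‖⁻¹ : ℝ) := by
  have h1 : ((‖w‖ ^ 2 : ℝ) + (2 * inner ℝ w v : ℝ) * s + (‖v‖ ^ 2 : ℝ) * s ^ 2 : ℂ) =
      ((‖w + s • v‖ ^ 2 : ℝ) : ℂ) := by
    rw [norm_add_sq_real, norm_smul, mul_pow, Real.norm_eq_abs, sq_abs, real_inner_smul_right]
    push_cast
    ring
  rw [h1, show (-(1 / 2) : ℂ) = ((-(1 / 2) : ℝ) : ℂ) by push_cast; ring,
    ← Complex.ofReal_cpow (by positivity), Real.rpow_neg (by positivity), ← Real.sqrt_eq_rpow,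
    Real.sqrt_sq (norm_nonneg _)]

lemma curvePotential_eq_const_on_ray {r : ℝ → EuclideanSpace ℝ (Fin 3)} {σ : ℝ → ℝ} {a b c : ℝ}
    {x v : EuclideanSpace ℝ (Fin 3)} (hr : Continuous r) (hσ : Continuous σ) (hv : v ≠ 0)
    (hle : ∀ t, ‖v‖ ≤ ‖x - r t‖) (hc : ∀ᶠ y in 𝓝 x, curvePotential r σ a b y = c) {s : ℝ}
    (hs : |s| < 1) : curvePotential r σ a b (x + s • v) = c := by
  set q : ℂ → ℝ → ℂ := fun z t =>
    (‖x - r t‖ ^ 2 : ℝ) + (2 * inner ℝ (x - r t) v : ℝ) * z + (‖v‖ ^ 2 : ℝ) * z ^ 2 with hq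
  set q' : ℂ → ℝ → ℂ := fun z t =>
    (2 * inner ℝ (x - r t) v : ℝ) + (‖v‖ ^ 2 : ℝ) * (2 * z) with hq'
  have hqc : Continuous (Function.uncurry q) := by
    simp only [hq, Function.uncurry_def]
    fun_prop
  have hqc' : Continuous (Function.uncurry q') := by
    simp only [hq', Function.uncurry_def]
    fun_prop
  have hslit : ∀ p ∈ complexDiamond ×ˢ (univ : Set ℝ),
      Function.uncurry q p ∈ Complex.slitPlane := fun p hp =>
    Or.inl (re_quadratic_pos hv (hle p.2) hp.1)
  have hpow : ∀ e : ℂ, ContinuousOn (fun p : ℂ × ℝ => Function.uncurry q p ^ e)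
      (complexDiamond ×ˢ univ) := fun e => hqc.continuousOn.cpow_const hslit
  have hσc : Continuous fun p : ℂ × ℝ => (σ p.2 : ℂ) := by fun_prop
  have hqd : ∀ z t, HasDerivAt (fun z => q z t) (q' z t) z := by
    intro z t
    have h1 := (hasDerivAt_id z).const_mul ((2 * inner ℝ (x - r t) v : ℝ) : ℂ)
    have h2 := ((hasDerivAt_id z).pow 2).const_mul ((‖v‖ ^ 2 : ℝ) : ℂ)
    refine HasDerivAt.congr_deriv ((h1.const_add _).add h2) ?_
    simp [hq']
  have hG : DifferentiableOn ℂ (fun z => ∫ t in a..b, (σ t : ℂ) * q z t ^ (-(1 / 2) : ℂ))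
      complexDiamond :=
    differentiableOn_intervalIntegral_of_continuousOn isOpen_complexDiamond
      (F := fun z t => (σ t : ℂ) * q z t ^ (-(1 / 2) : ℂ))
      (F' := fun z t => (σ t : ℂ) * ((-(1 / 2) : ℂ) * q z t ^ ((-(1 / 2) : ℂ) - 1) * q' z t))
      (hσc.continuousOn.mul (hpow _))
      (hσc.continuousOn.mul ((continuousOn_const.mul (hpow _)).mul hqc'.continuousOn))
      (fun z hz t => ((hqd z t).cpow_const (hslit (z, t) ⟨hz, trivial⟩)).const_mul _) a b
  have hGreal : ∀ s : ℝ, ∫ t in a..b, (σ t : ℂ) * q s t ^ (-(1 / 2) : ℂ) =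
      (curvePotential r σ a b (x + s • v) : ℝ) := by
    intro s
    rw [curvePotential, ← intervalIntegral.integral_ofReal]
    refine intervalIntegral.integral_congr fun t _ => ?_
    simp only [hq]
    rw [quadratic_cpow_ofReal, ← Complex.ofReal_mul, ← div_eq_mul_inv, add_sub_right_comm]
  have h0 : (0 : ℂ) ∈ complexDiamond := by simp [complexDiamond]
  have hfreq : ∃ᶠ z in 𝓝[≠] (0 : ℂ),
      (∫ t in a..b, (σ t : ℂ) * q z t ^ (-(1 / 2) : ℂ)) = (c : ℂ) := by
    have htend : Tendsto (fun s : ℝ => (s : ℂ)) (𝓝[≠] 0) (𝓝[≠] 0) := by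
      refine tendsto_nhdsWithin_iff.2 ⟨?_, ?_⟩
      · exact tendsto_nhdsWithin_of_tendsto_nhds (Complex.continuous_ofReal.tendsto' 0 0 rfl)
      · filter_upwards [self_mem_nhdsWithin] with s hs
        simpa using hs
    refine htend.frequently (Eventually.frequently ?_)
    have hline : Tendsto (fun s : ℝ => x + s • v) (𝓝[≠] 0) (𝓝 x) :=
      tendsto_nhdsWithin_of_tendsto_nhds (Continuous.tendsto' (by fun_prop) 0 x (by simp))
    filter_upwards [hline.eventually hc] with s hs
    rw [hGreal, hs]
  have := (hG.analyticOnNhd isOpen_complexDiamond).eqOn_of_preconnected_of_frequently_eq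
    analyticOnNhd_const convex_complexDiamond.isPreconnected h0 hfreq
    (show (s : ℂ) ∈ complexDiamond by simpa [complexDiamond] using hs)
  simp only [hGreal] at this
  exact_mod_cast this

lemma integral_div_add_mul {m L ε T : ℝ} (hL : 0 < L) (hε : 0 < ε) (hT : 0 ≤ T) (t₀ : ℝ) :
    ∫ t in t₀..t₀ + T, m / (ε + L * (t - t₀)) = m / L * Real.log (1 + T * L / ε) := by
  have hpos : ∀ t ∈ uIcc t₀ (t₀ + T), 0 < ε + L * (t - t₀) := by
    intro t ht
    rw [uIcc_of_le (by linarith)] at ht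
    have := mul_nonneg hL.le (sub_nonneg.2 ht.1)
    linarith
  have hd : ∀ t ∈ uIcc t₀ (t₀ + T), HasDerivAt (fun t => m / L * Real.log (ε + L * (t - t₀)))
      (m / (ε + L * (t - t₀))) t := by
    intro t ht
    have h := (((((hasDerivAt_id t).sub_const t₀).const_mul L).const_add ε).log
      (hpos t ht).ne').const_mul (m / L)
    refine HasDerivAt.congr_deriv h ?_
    have := hpos t ht
    simp only [id]
    field_simp
  rw [intervalIntegral.integral_eq_sub_of_hasDerivAt hd]
  · rw [sub_self, mul_zero, add_zero, add_sub_cancel_left, ← mul_sub, ← Real.log_div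
      (by positivity) hε.ne']
    congr 2
    field_simp
  · exact (ContinuousOn.div continuousOn_const (by fun_prop)
      fun t ht => (hpos t ht).ne').intervalIntegrable

lemma curvePotential_neg (r : ℝ → EuclideanSpace ℝ (Fin 3)) (σ : ℝ → ℝ) (a b : ℝ)
    (x : EuclideanSpace ℝ (Fin 3)) :
    curvePotential r (fun t => -σ t) a b x = -curvePotential r σ a b x := by
  simp [curvePotential, neg_div]

lemma not_eventually_eq_const_of_periodic {r : ℝ → EuclideanSpace ℝ (Fin 3)} {T c : ℝ}
    (hr : ContDiff ℝ 1 r) (hT : 0 < T) (hper : Function.Periodic r T) (hr' : ∀ t, deriv r t ≠ 0)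
    {x : EuclideanSpace ℝ (Fin 3)} (hx : x ∉ range r) :
    ¬ ∀ᶠ y in 𝓝 x, curvePotential r (fun t => ‖deriv r t‖) 0 T y = c := by
  intro hc
  have hrc : Continuous r := hr.continuous
  have hr'c : Continuous (deriv r) := hr.continuous_deriv le_rfl
  have hσc : Continuous fun t => ‖deriv r t‖ := hr'c.norm
  have hσper : Function.Periodic (fun t => ‖deriv r t‖) T := by
    intro t
    have : (fun s => r (s + T)) = r := funext hper
    simp only
    rw [← deriv_comp_add_const, this]
  have hσK := hσper.compact_of_continuous hT.ne' hσc
  obtain ⟨_, ⟨t₁, rfl⟩, hmin⟩ := hσK.exists_isLeast (range_nonempty _)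
  obtain ⟨_, ⟨t₂, rfl⟩, hmax⟩ := hσK.exists_isGreatest (range_nonempty _)
  set m := ‖deriv r t₁‖
  set L := ‖deriv r t₂‖
  have hm : 0 < m := norm_pos_iff.2 (hr' t₁)
  have hL : 0 < L := norm_pos_iff.2 (hr' t₂)
  have hlip : ∀ s t, ‖r t - r s‖ ≤ L * ‖t - s‖ := fun s t =>
    convex_univ.norm_image_sub_le_of_norm_deriv_le
      (fun u _ => (hr.differentiable one_ne_zero) u) (fun u _ => hmax ⟨u, rfl⟩) trivial trivial
  obtain ⟨_, ⟨t₀, rfl⟩, hnear⟩ := (hper.compact_of_continuous hT.ne' hrc).exists_isMinOn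
    (range_nonempty r) (f := fun y => ‖x - y‖) (by fun_prop)
  set v := r t₀ - x with hvdef
  have hv : v ≠ 0 := sub_ne_zero.2 fun h => hx ⟨t₀, h⟩
  have hd : 0 < ‖v‖ := norm_pos_iff.2 hv
  have hle : ∀ t, ‖v‖ ≤ ‖x - r t‖ := fun t => by
    rw [hvdef, norm_sub_rev]
    exact hnear ⟨t, rfl⟩
  set A := Real.exp (c * L / m) with hA
  set ε := min ‖v‖ (T * L / A) with hεdef
  have hε : 0 < ε := lt_min hd (by positivity)
  have hεv : ε / ‖v‖ ≤ 1 := (div_le_one hd).2 (min_le_left _ _)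
  have hεv0 : 0 < ε / ‖v‖ := by positivity
  have hval := curvePotential_eq_const_on_ray hrc hσc hv hle hc (s := 1 - ε / ‖v‖)
    (by rw [abs_lt]; constructor <;> linarith)
  set y := x + (1 - ε / ‖v‖) • v with hy
  have hyr : ∀ t, ‖y - r t‖ ≤ ε + L * |t - t₀| := by
    intro t
    have h1 : y - r t = (r t₀ - r t) - (ε / ‖v‖) • v := by
      rw [hy, sub_smul, one_smul, hvdef]; abel
    have h2 : ‖(ε / ‖v‖) • v‖ = ε := by
      rw [norm_smul, Real.norm_of_nonneg hεv0.le, div_mul_cancel₀ _ hd.ne']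
    have h3 := hlip t t₀
    rw [Real.norm_eq_abs, abs_sub_comm] at h3
    rw [h1]
    linarith [norm_sub_le (r t₀ - r t) ((ε / ‖v‖) • v)]
  have hypos : ∀ t, 0 < ‖y - r t‖ := by
    intro t
    have h1 : ‖x - y‖ = ‖v‖ - ε := by
      rw [hy, sub_add_cancel_left, norm_neg, norm_smul, Real.norm_of_nonneg (by linarith)]
      field_simp
    linarith [norm_sub_le_norm_sub_add_norm_sub x y (r t), hle t]
  have hfper : Function.Periodic (fun t => ‖deriv r t‖ / ‖y - r t‖) T := fun t => by
    simp only [hper t, hσper t]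
  have hshift := hfper.intervalIntegral_add_eq 0 t₀
  rw [zero_add] at hshift
  rw [curvePotential, hshift] at hval
  have hlow : m / L * Real.log (1 + T * L / ε) ≤ c := by
    rw [← integral_div_add_mul hL hε hT.le t₀, ← hval]
    have hpos : ∀ t ∈ Icc t₀ (t₀ + T), 0 < ε + L * (t - t₀) := fun t ht => by
      have := mul_nonneg hL.le (sub_nonneg.2 ht.1)
      linarith
    refine intervalIntegral.integral_mono_on (by linarith) ?_ ?_ fun t ht => ?_
    · refine (ContinuousOn.div continuousOn_const (by fun_prop)
        fun t ht => (hpos t ?_).ne').intervalIntegrable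
      rwa [uIcc_of_le (by linarith)] at ht
    · exact (hσc.div (by fun_prop) fun t => (hypos t).ne').intervalIntegrable _ _
    · have h1 := hyr t
      rw [abs_of_nonneg (sub_nonneg.2 ht.1)] at h1
      exact div_le_div₀ (norm_nonneg _) (hmin ⟨t, rfl⟩) (hypos t) h1
  have hAle : A ≤ T * L / ε := by
    rw [le_div_iff₀ hε, mul_comm, ← le_div_iff₀ (Real.exp_pos _)]
    exact min_le_right _ _
  have hlog : c * L / m < Real.log (1 + T * L / ε) := by
    rw [Real.lt_log_iff_exp_lt (by positivity)]
    linarith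
  have h1 := mul_lt_mul_of_pos_left hlog (div_pos hm hL)
  rw [show m / L * (c * L / m) = c by field_simp] at h1
  linarith


/-- The electric potential has no local extrema on the complement of the knot. -/
theorem potential_no_local_extrema
    (r : ℝ → EuclideanSpace ℝ (Fin 3))
    (hr : ContDiff ℝ (⊤ : ℕ∞) r)
    (hper : Function.Periodic r (2 * Real.pi))
    (hinj : Set.InjOn r (Set.Ico 0 (2 * Real.pi)))
    (hr' : ∀ t, deriv r t ≠ 0)
    (K : Set (EuclideanSpace ℝ (Fin 3))) (hK : K = Set.range r)
    (Φ : EuclideanSpace ℝ (Fin 3) → ℝ)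
    (hΦ : ∀ x, Φ x = ∫ t in (0:ℝ)..(2 * Real.pi), ‖deriv r t‖ / ‖x - r t‖)
    (x : EuclideanSpace ℝ (Fin 3)) (hx : x ∉ K) :
    ¬ IsLocalMaxOn Φ ((Set.univ : Set (EuclideanSpace ℝ (Fin 3))) \ K) x ∧
    ¬ IsLocalMinOn Φ ((Set.univ : Set (EuclideanSpace ℝ (Fin 3))) \ K) x := by
  have hrc : Continuous r := hr.continuous
  have hr1 : ContDiff ℝ 1 r := hr.of_le (by exact_mod_cast le_top)
  have hσc : Continuous fun t => ‖deriv r t‖ := (hr1.continuous_deriv le_rfl).norm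
  have hT : 0 < 2 * Real.pi := Real.two_pi_pos
  obtain rfl : Φ = curvePotential r (fun t => ‖deriv r t‖) 0 (2 * Real.pi) := funext hΦ
  subst hK
  have hopen : IsOpen (univ \ range r) := by
    rw [← compl_eq_univ_sdiff]
    exact (hper.compact_of_continuous hT.ne' hrc).isClosed.isOpen_compl
  have hnhds : univ \ range r ∈ 𝓝 x := hopen.mem_nhds ⟨trivial, hx⟩
  obtain ⟨D, hD, hball⟩ := Metric.mem_nhds_iff.1 hnhds
  have hdist : ∀ t, D ≤ ‖x - r t‖ := fun t => by
    by_contra! hlt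
    exact (hball (by rwa [mem_ball', dist_eq_norm] : r t ∈ ball x D)).2 ⟨t, rfl⟩
  refine ⟨fun h => ?_, fun h => ?_⟩
  · obtain ⟨ρ, hρ, hsub⟩ := Metric.mem_nhds_iff.1 (h.isLocalMax hnhds)
    have hρ' : 0 < min ρ (D / 2) := lt_min hρ (half_pos hD)
    refine not_eventually_eq_const_of_periodic
      (c := curvePotential r (fun t => ‖deriv r t‖) 0 (2 * Real.pi) x) hr1 hT hper hr' hx
      (Filter.mem_of_superset (ball_mem_nhds x hρ') ?_)
    exact curvePotential_eqOn_ball_of_le hrc hσc hT.le hρ'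
      ((min_le_right _ _).trans_lt (half_lt_self hD)) hdist
      fun y hy => hsub (ball_subset_ball (min_le_left _ _) hy)
  · obtain ⟨ρ, hρ, hsub⟩ := Metric.mem_nhds_iff.1 (h.isLocalMin hnhds)
    have hρ' : 0 < min ρ (D / 2) := lt_min hρ (half_pos hD)
    refine not_eventually_eq_const_of_periodic
      (c := curvePotential r (fun t => ‖deriv r t‖) 0 (2 * Real.pi) x) hr1 hT hper hr' hx
      (Filter.mem_of_superset (ball_mem_nhds x hρ') ?_)
    have := curvePotential_eqOn_ball_of_le (σ := fun t => -‖deriv r t‖) hrc hσc.neg hT.le hρ'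
      ((min_le_right _ _).trans_lt (half_lt_self hD)) hdist
    simp only [curvePotential_neg, neg_le_neg_iff, neg_inj] at this
    exact this fun y hy => hsub (ball_subset_ball (min_le_left _ _) hy)
end

section
/- The complement of a smooth knot in ℝ³ is path-connected: the set (EuclideanSpace ℝ (Fin 3)) \ K is path-connected. (This is the H₀ ≅ ℤ part of the computation of the homology of a knot complement.) -/
open Module in
/-- The union of all lines through `x` and a point of the image of a `C¹` map. -/
theorem ContDiff.dimH_range_cone_le {E F : Type*}
    [NormedAddCommGroup E] [NormedSpace ℝ E] [FiniteDimensional ℝ E]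
    [NormedAddCommGroup F] [NormedSpace ℝ F] {f : E → F} (hf : ContDiff ℝ 1 f) (x : F) :
    dimH (Set.range fun p : ℝ × E => x + p.1 • (f p.2 - x)) ≤ (finrank ℝ E + 1 : ℕ) := by
  have h : ContDiff ℝ 1 fun p : ℝ × E => x + p.1 • (f p.2 - x) := by fun_prop
  simpa [finrank_prod, add_comm] using h.dimH_range_le

/-- A point outside the union of the lines through `x` and points of the range of `f` sees
`x` without crossing this range. -/
theorem joinedIn_compl_range_of_notMem_cone {E F : Type*}
    [NormedAddCommGroup F] [NormedSpace ℝ F] {f : E → F} {x p : F} (hx : x ∉ Set.range f)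
    (hp : p ∉ Set.range fun q : ℝ × E => x + q.1 • (f q.2 - x)) :
    JoinedIn (Set.range f)ᶜ x p := by
  refine JoinedIn.of_segment_subset ?_
  rw [segment_eq_image']
  rintro _ ⟨θ, -, rfl⟩ ⟨t, ht⟩
  have hθ : θ ≠ 0 := by
    rintro rfl
    exact hx ⟨t, by simpa using ht⟩
  exact hp ⟨(θ⁻¹, t), by simp [ht, smul_smul, hθ]⟩

open Module in
/-- The complement of the image of a `C¹` map of codimension at least two is path-connected. -/
theorem ContDiff.isPathConnected_compl_range {E F : Type*}
    [NormedAddCommGroup E] [NormedSpace ℝ E] [FiniteDimensional ℝ E]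
    [NormedAddCommGroup F] [NormedSpace ℝ F] [FiniteDimensional ℝ F]
    {f : E → F} (hf : ContDiff ℝ 1 f) (h : finrank ℝ E + 1 < finrank ℝ F) :
    IsPathConnected (Set.range f)ᶜ := by
  rw [isPathConnected_iff]
  refine ⟨(hf.dense_compl_range_of_finrank_lt_finrank (by lia)).nonempty, fun x hx y hy => ?_⟩
  have hlt : dimH ((Set.range fun q : ℝ × E => x + q.1 • (f q.2 - x)) ∪
      Set.range fun q : ℝ × E => y + q.1 • (f q.2 - y)) < finrank ℝ F := by
    rw [dimH_union]
    exact (max_le (hf.dimH_range_cone_le x) (hf.dimH_range_cone_le y)).trans_lt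
      (by exact_mod_cast h)
  obtain ⟨p, hp⟩ := (dense_compl_of_dimH_lt_finrank hlt).nonempty
  rw [Set.mem_compl_iff, Set.mem_union, not_or] at hp
  exact (joinedIn_compl_range_of_notMem_cone hx hp.1).trans
    (joinedIn_compl_range_of_notMem_cone hy hp.2).symm

/-- The complement of a smooth knot in `ℝ³` is path-connected. -/
theorem knot_complement_pathConnected
    (r : ℝ → EuclideanSpace ℝ (Fin 3))
    (hr : ContDiff ℝ (⊤ : ℕ∞) r)
    (hper : Function.Periodic r (2 * Real.pi))
    (hinj : Set.InjOn r (Set.Ico 0 (2 * Real.pi)))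
    (hr' : ∀ t, deriv r t ≠ 0)
    (K : Set (EuclideanSpace ℝ (Fin 3))) (hK : K = Set.range r) :
    IsPathConnected ((Set.univ : Set (EuclideanSpace ℝ (Fin 3))) \ K) := by
  rw [hK, ← Set.compl_eq_univ_sdiff]
  exact (hr.of_le (by exact_mod_cast le_top)).isPathConnected_compl_range (by simp)
end
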